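/- arXiv:2006.14164 — 4 statements merged into one kernel-verified Lean document; each statement's English description precedes it below -/
import Mathlib

section
/- Given positive integers n₁, …, n_m and N, define the labeled weighted automaton A₂ over the monoid (ℕ, +, 0) with states q₀, …, q_m, q_{m+1}¹, q_{m+1}², unique initial state q₀, unobservable events u₁, u₂ (ℓ(u₁) = ℓ(u₂) = ε) and observable event e (ℓ(e) = e), and transitions qᵢ →^{u₁ / n_{i+1}} q_{i+1} and qᵢ →^{u₂ / 0} q_{i+1} for 0 ≤ i ≤ m−1, q_m →^{e / 1} q_{m+1}¹, q₀ →^{e / N+1} q_{m+1}², q_{m+1}¹ →^{e / 1} q_{m+1}¹ and q_{m+1}² →^{e / 1} q_{m+1}². Then A₂ is deterministic, deadlock-free and divergence-free, and there exists I ⊆ {1, …, m} with N = Σ_{i∈I} nᵢ if and only if A₂ is NOT strongly detectable. -/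
namespace LWAD

/-- A labeled weighted automaton over a monoid `T`: `lbl e = none` means that
event `e` is unobservable (label ε); initial states all have initial weight `1`. -/
structure LWA (T Q E S : Type*) [Monoid T] where
  trans : Set (Q × E × Q)
  init : Set Q
  wt : Q → E → Q → T
  lbl : E → Option S

variable {T Q E S : Type*} [Monoid T]

/-- A chain (path) over a labeled transition relation `r`; each entry of the
list records the letter and the next state. -/
def Chain {V α : Type*} (r : V → α → V → Prop) : V → List (α × V) → Prop
  | _, [] => True
  | v, (a, u) :: l => r v a u ∧ Chain r u l

/-- The final state of a chain. -/
def chainEnd {V α : Type*} (v : V) (l : List (α × V)) : V :=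
  (l.getLast?.map Prod.snd).getD v

/-- `v'` is reachable from `v` via the labeled transition relation `r`. -/
def ReachVia {V α : Type*} (r : V → α → V → Prop) (v v' : V) : Prop :=
  ∃ l, Chain r v l ∧ chainEnd v l = v'

/-- `IsPath A q l`: `l` is a (possibly empty) path of `A` starting at `q`. -/
def IsPath (A : LWA T Q E S) : Q → List (E × Q) → Prop :=
  Chain fun q e q' => (q, e, q') ∈ A.trans

/-- The end state of a path. -/
def pathEnd (q : Q) (l : List (E × Q)) : Q := chainEnd q l

/-- The weight of a path: the ordered product of its transition weights. -/
def pathWeight (A : LWA T Q E S) : Q → List (E × Q) → T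
  | _, [] => 1
  | q, (e, q') :: l => A.wt q e q' * pathWeight A q' l

/-- Weighted word of a path, with accumulated weight `t`. -/
def wwordAux (A : LWA T Q E S) : T → Q → List (E × Q) → List (E × T)
  | _, _, [] => []
  | t, q, (e, q') :: l => (e, t * A.wt q e q') :: wwordAux A (t * A.wt q e q') q' l

/-- τ(π): the weighted word of the path `l` starting at `q`. -/
def pathWWord (A : LWA T Q E S) (q : Q) (l : List (E × Q)) : List (E × T) :=
  wwordAux A 1 q l

/-- All events of the path are unobservable. -/
def Unobs (A : LWA T Q E S) (l : List (E × Q)) : Prop := ∀ p ∈ l, A.lbl p.1 = none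

/-- The path is instantaneous: all entries of its weighted word equal `1`. -/
def Inst (A : LWA T Q E S) (q : Q) (l : List (E × Q)) : Prop :=
  ∀ p ∈ pathWWord A q l, p.2 = 1

/-- The labeling `ℓ` extended letterwise to weighted words. -/
def obsW (A : LWA T Q E S) (w : List (E × T)) : List (S × T) :=
  w.filterMap fun p => (A.lbl p.1).map fun σ => (σ, p.2)

/-- `M(A, ε | x)`: states reachable from `x` by unobservable instantaneous paths. -/
def instClosure (A : LWA T Q E S) (x : Set Q) : Set Q :=
  {q | ∃ q₀ ∈ x, ∃ l, IsPath A q₀ l ∧ Unobs A l ∧ Inst A q₀ l ∧ pathEnd q₀ l = q}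

/-- `M(A, γ | x)` for nonempty weighted label sequences `γ`. -/
def estPos (A : LWA T Q E S) (x : Set Q) (γ : List (S × T)) : Set Q :=
  {q | ∃ q₀ ∈ x, ∃ s₁ s₂ : List (E × Q),
        IsPath A q₀ (s₁ ++ s₂) ∧
        (∃ p, s₁.getLast? = some p ∧ A.lbl p.1 ≠ none) ∧
        obsW A (pathWWord A q₀ s₁) = γ ∧
        Unobs A s₂ ∧ Inst A (pathEnd q₀ s₁) s₂ ∧
        pathEnd (pathEnd q₀ s₁) s₂ = q}

/-- The current-state estimate `M(A, γ | x)`. -/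
def est (A : LWA T Q E S) (x : Set Q) : List (S × T) → Set Q
  | [] => instClosure A x
  | γ => estPos A x γ

/-- An infinite path of `A` starting at an initial state. -/
structure InfPath (A : LWA T Q E S) where
  st : ℕ → Q
  ev : ℕ → E
  first : st 0 ∈ A.init
  valid : ∀ i, (st i, ev i, st (i + 1)) ∈ A.trans

/-- The ω-weighted word of an infinite path. -/
def InfPath.wword {A : LWA T Q E S} (π : InfPath A) (i : ℕ) : E × T :=
  (π.ev i, ((List.range (i + 1)).map fun j => A.wt (π.st j) (π.ev j) (π.st (j + 1))).prod)

/-- `L^ω(A)`: the ω-weighted words of infinite initial paths of `A`. -/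
def omegaLang (A : LWA T Q E S) : Set (ℕ → E × T) :=
  {w | ∃ π : InfPath A, ∀ i, π.wword i = w i}

/-- The length-`n` prefix of an infinite word. -/
def pre {β : Type*} (w : ℕ → β) (n : ℕ) : List β := (List.range n).map w

/-- The segment `w(n) ⋯ w(n+k-1)` of an infinite word. -/
def seg {β : Type*} (w : ℕ → β) (n k : ℕ) : List β := (List.range k).map fun i => w (n + i)

def StronglyDetectable (A : LWA T Q E S) : Prop :=
  ∃ t : ℕ, 0 < t ∧ ∀ w ∈ omegaLang A, ∀ n : ℕ,
    t ≤ (obsW A (pre w n)).length → (est A A.init (obsW A (pre w n))).ncard = 1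

def StronglyPeriodicallyDetectable (A : LWA T Q E S) : Prop :=
  ∃ t : ℕ, 0 < t ∧ ∀ w ∈ omegaLang A, ∀ n : ℕ, ∃ k : ℕ,
    (obsW A (seg w n k)).length < t ∧
    (est A A.init (obsW A (pre w (n + k)))).ncard = 1

def WeaklyDetectable (A : LWA T Q E S) : Prop :=
  (omegaLang A).Nonempty → ∃ t : ℕ, 0 < t ∧ ∃ w ∈ omegaLang A, ∀ n : ℕ,
    t ≤ (obsW A (pre w n)).length → (est A A.init (obsW A (pre w n))).ncard = 1

def WeaklyPeriodicallyDetectable (A : LWA T Q E S) : Prop :=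
  (omegaLang A).Nonempty → ∃ t : ℕ, 0 < t ∧ ∃ w ∈ omegaLang A, ∀ n : ℕ, ∃ k : ℕ,
    (obsW A (seg w n k)).length < t ∧
    (est A A.init (obsW A (pre w (n + k)))).ncard = 1

def Reachable (A : LWA T Q E S) (q : Q) : Prop :=
  ∃ q₀ ∈ A.init, ∃ l, IsPath A q₀ l ∧ pathEnd q₀ l = q

def DeadlockFree (A : LWA T Q E S) : Prop :=
  ∀ q, Reachable A q → ∃ e q', (q, e, q') ∈ A.trans

def DivergenceFree (A : LWA T Q E S) : Prop :=
  ¬ ∃ q, Reachable A q ∧ ∃ l, l ≠ [] ∧ IsPath A q l ∧ Unobs A l ∧ pathEnd q l = q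

def Deterministic (A : LWA T Q E S) : Prop :=
  (∃ q, A.init = {q}) ∧
  ∀ q e q' q'', (q, e, q') ∈ A.trans → (q, e, q'') ∈ A.trans → q' = q''

/-- The transition relation of the self-composition `CC(A)`. -/
def CCTrans (A : LWA T Q E S) (p : Q × Q) (ee : E × E) (p' : Q × Q) : Prop :=
  A.lbl ee.1 ≠ none ∧ A.lbl ee.1 = A.lbl ee.2 ∧
  ∃ (s₁ s₂ s₃ s₄ : List (E × Q)) (q₇ q₈ : Q),
    IsPath A p.1 (s₁ ++ (ee.1, q₇) :: s₃) ∧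
    IsPath A p.2 (s₂ ++ (ee.2, q₈) :: s₄) ∧
    Unobs A s₁ ∧ Unobs A s₂ ∧ Unobs A s₃ ∧ Unobs A s₄ ∧
    Inst A q₇ s₃ ∧ Inst A q₈ s₄ ∧
    pathEnd q₇ s₃ = p'.1 ∧ pathEnd q₈ s₄ = p'.2 ∧
    pathWeight A p.1 (s₁ ++ [(ee.1, q₇)]) = pathWeight A p.2 (s₂ ++ [(ee.2, q₈)])

/-- The state set `X` of the pre-observer of `A`. -/
def obsStates (A : LWA T Q E S) : Set (Set Q) :=
  insert (est A A.init []) {x | x.Nonempty ∧ ∃ γ : List (S × T), γ ≠ [] ∧ est A A.init γ = x}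

/-- The transition relation of the pre-observer of `A`. -/
def PreObsTrans (A : LWA T Q E S) (x : Set Q) (st : S × T) (x' : Set Q) : Prop :=
  x ∈ obsStates A ∧ x' ∈ obsStates A ∧ x' = estPos A x [st]

/-- An observer of `A`: a finite-alphabet subautomaton of its pre-observer that
keeps at least one transition between every connected pair of states. -/
structure Observer (A : LWA T Q E S) where
  alph : Set (S × T)
  alph_fin : alph.Finite
  tr : Set (Set Q × (S × T) × Set Q)
  tr_sub : ∀ x st x', (x, st, x') ∈ tr → st ∈ alph ∧ PreObsTrans A x st x'
  tr_cover : ∀ x x', (∃ st, PreObsTrans A x st x') → ∃ st, (x, st, x') ∈ tr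

def ObsRel {A : LWA T Q E S} (O : Observer A) (x : Set Q) (st : S × T) (x' : Set Q) : Prop :=
  (x, st, x') ∈ O.tr

/-- The state set of the pre-detector of `A`. -/
def detStates (A : LWA T Q E S) : Set (Set Q) :=
  insert (est A A.init []) {x | 1 ≤ x.ncard ∧ x.ncard ≤ 2}

/-- The transition relation of the pre-detector of `A`. -/
def PreDetTrans (A : LWA T Q E S) (x : Set Q) (st : S × T) (x' : Set Q) : Prop :=
  x ∈ detStates A ∧
  (((estPos A x [st]).ncard = 1 ∧ x' = estPos A x [st]) ∨
    (2 ≤ (estPos A x [st]).ncard ∧ x' ⊆ estPos A x [st] ∧ x'.ncard = 2))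

/-- A detector of `A`: a finite-alphabet subautomaton of its pre-detector that
keeps at least one transition between every connected pair of states. -/
structure Detector (A : LWA T Q E S) where
  alph : Set (S × T)
  alph_fin : alph.Finite
  tr : Set (Set Q × (S × T) × Set Q)
  tr_sub : ∀ x st x', (x, st, x') ∈ tr → st ∈ alph ∧ PreDetTrans A x st x'
  tr_cover : ∀ x x', (∃ st, PreDetTrans A x st x') → ∃ st, (x, st, x') ∈ tr

def DetRel {A : LWA T Q E S} (D : Detector A) (x : Set Q) (st : S × T) (x' : Set Q) : Prop :=
  (x, st, x') ∈ D.tr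


/-- The three events of the automaton `A₂`: `u1`, `u2` are unobservable, `vis`
(the event `e` of the paper) is observable. -/
inductive Ev : Type
  | u1 | u2 | vis

/-- The automaton `A₂` over the monoid `(ℕ, +, 0)` (encoded as
`Multiplicative ℕ`) built from positive integers `n₁, …, n_m` and `N`.
States: `Sum.inl i` is `qᵢ` (`0 ≤ i ≤ m`), `Sum.inr false` is `q_{m+1}¹` and
`Sum.inr true` is `q_{m+1}²`. -/
def A2 (m : ℕ) (nv : Fin m → ℕ) (N : ℕ) :
    LWA (Multiplicative ℕ) (Fin (m + 1) ⊕ Bool) Ev Unit where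
  trans := {t |
    (∃ i : Fin m, t = (Sum.inl i.castSucc, Ev.u1, Sum.inl i.succ)) ∨
    (∃ i : Fin m, t = (Sum.inl i.castSucc, Ev.u2, Sum.inl i.succ)) ∨
    t = (Sum.inl (Fin.last m), Ev.vis, Sum.inr false) ∨
    t = (Sum.inl 0, Ev.vis, Sum.inr true) ∨
    t = (Sum.inr false, Ev.vis, Sum.inr false) ∨
    t = (Sum.inr true, Ev.vis, Sum.inr true)}
  init := {Sum.inl 0}
  wt := fun q e q' => Multiplicative.ofAdd (
    match q, e, q' with
    | Sum.inl i, Ev.u1, _ => if h : (i : ℕ) < m then nv ⟨(i : ℕ), h⟩ else 0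
    | _, Ev.u2, _ => 0
    | Sum.inl _, Ev.vis, Sum.inr true => N + 1
    | _, _, _ => 1)
  lbl := fun e => match e with | Ev.vis => some () | _ => none

/-- Observation words: `K` consecutive ticks starting at time `a`. -/
def tick (a K : ℕ) : List (Unit × Multiplicative ℕ) :=
  (List.range' a K).map fun k => ((), Multiplicative.ofAdd k)

theorem tick_succ (a K : ℕ) :
    tick a (K + 1) = ((), Multiplicative.ofAdd a) :: tick (a + 1) K := by
  simp [tick, List.range'_succ]

theorem tick_inj {a b K L : ℕ} (h : tick a (K + 1) = tick b (L + 1)) : a = b := by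
  rw [tick_succ, tick_succ] at h
  simp at h
  exact h.1

theorem pathEnd_nil {Q E : Type*} (q : Q) : pathEnd (E := E) q [] = q := rfl

theorem pathEnd_cons {Q E : Type*} (q : Q) (p : E × Q) (l : List (E × Q)) :
    pathEnd q (p :: l) = pathEnd p.2 l := by
  cases l with
  | nil => rfl
  | cons a l =>
    simp only [pathEnd, chainEnd, List.getLast?_cons_cons]
    rw [List.getLast?_cons]; rfl

theorem pathEnd_append {Q E : Type*} (q : Q) (l l' : List (E × Q)) :
    pathEnd q (l ++ l') = pathEnd (pathEnd q l) l' := by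
  induction l generalizing q with
  | nil => rfl
  | cons a l ih => simp [pathEnd_cons, ih]

section gen
variable {T Q E S : Type*} [Monoid T]

theorem isPath_cons (A : LWA T Q E S) (q q' : Q) (e : E) (l : List (E × Q)) :
    IsPath A q ((e, q') :: l) ↔ (q, e, q') ∈ A.trans ∧ IsPath A q' l := Iff.rfl

theorem isPath_append (A : LWA T Q E S) (q : Q) (l l' : List (E × Q)) :
    IsPath A q (l ++ l') ↔ IsPath A q l ∧ IsPath A (pathEnd q l) l' := by
  induction l generalizing q with
  | nil => simp [pathEnd_nil, IsPath, Chain]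
  | cons a l ih =>
    obtain ⟨e, q'⟩ := a
    simp [isPath_cons, pathEnd_cons, ih, and_assoc]

theorem wwordAux_append (A : LWA T Q E S) (t : T) (q : Q) (l l' : List (E × Q)) :
    wwordAux A t q (l ++ l') =
      wwordAux A t q l ++ wwordAux A (t * pathWeight A q l) (pathEnd q l) l' := by
  induction l generalizing q t with
  | nil => simp [pathEnd_nil, wwordAux, pathWeight]
  | cons a l ih =>
    obtain ⟨e, q'⟩ := a
    simp [wwordAux, pathEnd_cons, pathWeight, ih, mul_assoc]

theorem pathWeight_append (A : LWA T Q E S) (q : Q) (l l' : List (E × Q)) :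
    pathWeight A q (l ++ l') = pathWeight A q l * pathWeight A (pathEnd q l) l' := by
  induction l generalizing q with
  | nil => simp [pathEnd_nil, pathWeight]
  | cons a l ih =>
    obtain ⟨e, q'⟩ := a
    simp [pathEnd_cons, pathWeight, ih, mul_assoc]

/-- The finite prefix of an infinite path. -/
def prePath {A : LWA T Q E S} (π : InfPath A) (n : ℕ) : List (E × Q) :=
  (List.range n).map fun i => (π.ev i, π.st (i + 1))

theorem prePath_spec {A : LWA T Q E S} (π : InfPath A) (n : ℕ) :
    IsPath A (π.st 0) (prePath π n) ∧ pathEnd (π.st 0) (prePath π n) = π.st n ∧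
    pathWeight A (π.st 0) (prePath π n) =
      ((List.range n).map fun j => A.wt (π.st j) (π.ev j) (π.st (j + 1))).prod ∧
    pathWWord A (π.st 0) (prePath π n) = pre π.wword n := by
  induction n with
  | zero => simp [prePath, IsPath, Chain, pathEnd_nil, pathWeight, pathWWord, wwordAux, pre]
  | succ n ih =>
    obtain ⟨h1, h2, h3, h4⟩ := ih
    have e : prePath π (n + 1) = prePath π n ++ [(π.ev n, π.st (n + 1))] := by
      simp [prePath, List.range_succ]
    refine ⟨?_, ?_, ?_, ?_⟩
    · rw [e, isPath_append, h2]
      exact ⟨h1, π.valid n, trivial⟩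
    · rw [e, pathEnd_append]; rfl
    · rw [e, pathWeight_append, h2, h3]
      simp [List.range_succ, pathWeight]
    · unfold pathWWord at *
      rw [e, wwordAux_append, h4, h2, h3]
      simp [pre, List.range_succ, wwordAux, InfPath.wword]

end gen

section a2
variable {m : ℕ} {nv : Fin m → ℕ} {N : ℕ}

/-- Observation of a path of `A2` starting at time `t`. -/
def obsP (m : ℕ) (nv : Fin m → ℕ) (N t : ℕ) (q : Fin (m + 1) ⊕ Bool)
    (l : List (Ev × (Fin (m + 1) ⊕ Bool))) : List (Unit × Multiplicative ℕ) :=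
  obsW (A2 m nv N) (wwordAux (A2 m nv N) (Multiplicative.ofAdd t) q l)

theorem obsP_nil (t q) : obsP m nv N t q [] = [] := rfl

theorem obsP_u1 (t) (i : Fin m) (q' l) :
    obsP m nv N t (Sum.inl i.castSucc) ((Ev.u1, q') :: l) = obsP m nv N (t + nv i) q' l := by
  simp [obsP, obsW, wwordAux, A2, ofAdd_add]

theorem obsP_u2 (t) (i : Fin m) (q' l) :
    obsP m nv N t (Sum.inl i.castSucc) ((Ev.u2, q') :: l) = obsP m nv N t q' l := by
  simp [obsP, obsW, wwordAux, A2]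

theorem obsP_false (t) (q l) :
    obsP m nv N t q ((Ev.vis, Sum.inr false) :: l) =
      ((), Multiplicative.ofAdd (t + 1)) :: obsP m nv N (t + 1) (Sum.inr false) l := by
  cases q <;> simp [obsP, obsW, wwordAux, A2, ofAdd_add]

theorem obsP_start (t) (i l) :
    obsP m nv N t (Sum.inl i) ((Ev.vis, Sum.inr true) :: l) =
      ((), Multiplicative.ofAdd (t + N + 1)) :: obsP m nv N (t + N + 1) (Sum.inr true) l := by
  simp [obsP, obsW, wwordAux, A2, ofAdd_add, mul_assoc]

theorem obsP_true (t) (l) :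
    obsP m nv N t (Sum.inr true) ((Ev.vis, Sum.inr true) :: l) =
      ((), Multiplicative.ofAdd (t + 1)) :: obsP m nv N (t + 1) (Sum.inr true) l := by
  simp [obsP, obsW, wwordAux, A2, ofAdd_add]

theorem mem_trans (q e q') : (q, e, q') ∈ (A2 m nv N).trans ↔
    (∃ i : Fin m, q = Sum.inl i.castSucc ∧ e = Ev.u1 ∧ q' = Sum.inl i.succ) ∨
    (∃ i : Fin m, q = Sum.inl i.castSucc ∧ e = Ev.u2 ∧ q' = Sum.inl i.succ) ∨
    (q = Sum.inl (Fin.last m) ∧ e = Ev.vis ∧ q' = Sum.inr false) ∨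
    (q = Sum.inl 0 ∧ e = Ev.vis ∧ q' = Sum.inr true) ∨
    (q = Sum.inr false ∧ e = Ev.vis ∧ q' = Sum.inr false) ∨
    (q = Sum.inr true ∧ e = Ev.vis ∧ q' = Sum.inr true) := by
  simp [A2]

theorem loop_trans (b : Bool) (e q') : (Sum.inr b, e, q') ∈ (A2 m nv N).trans ↔
    e = Ev.vis ∧ q' = Sum.inr b := by
  rw [mem_trans]
  cases b <;> simp

theorem loop_spec (b : Bool) (t : ℕ) (l) (h : IsPath (A2 m nv N) (Sum.inr b) l) :
    pathEnd (Sum.inr b) l = Sum.inr b ∧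
      obsP m nv N t (Sum.inr b) l = tick (t + 1) l.length := by
  induction l generalizing t with
  | nil => exact ⟨rfl, rfl⟩
  | cons a l ih =>
    obtain ⟨e, q'⟩ := a
    rw [isPath_cons, loop_trans] at h
    obtain ⟨⟨rfl, rfl⟩, h⟩ := h
    rw [pathEnd_cons, List.length_cons, tick_succ, ← (ih (t + 1) h).2]
    refine ⟨(ih t h).1, ?_⟩
    cases b
    · exact obsP_false _ _ _
    · exact obsP_true _ _

theorem loop_path (b : Bool) (K : ℕ) :
    IsPath (A2 m nv N) (Sum.inr b) (List.replicate K (Ev.vis, Sum.inr b)) := by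
  induction K with
  | zero => trivial
  | succ K ih => exact ⟨(loop_trans _ _ _).2 ⟨rfl, rfl⟩, ih⟩

theorem sound (i : Fin (m + 1)) (t : ℕ) (l) (h : IsPath (A2 m nv N) (Sum.inl i) l) :
    ((∃ j, pathEnd (Sum.inl i) l = Sum.inl j) ∧ obsP m nv N t (Sum.inl i) l = []) ∨
    (pathEnd (Sum.inl i) l = Sum.inr false ∧ ∃ I : Finset (Fin m), (∀ k ∈ I, i ≤ k.castSucc) ∧
      ∃ K, obsP m nv N t (Sum.inl i) l = tick (t + ∑ k ∈ I, nv k + 1) (K + 1)) ∨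
    (pathEnd (Sum.inl i) l = Sum.inr true ∧ i = 0 ∧
      ∃ K, obsP m nv N t (Sum.inl i) l = tick (t + N + 1) (K + 1)) := by
  induction l generalizing i t with
  | nil => exact Or.inl ⟨⟨i, rfl⟩, rfl⟩
  | cons a l ih =>
    obtain ⟨e, q'⟩ := a
    rw [isPath_cons, mem_trans] at h
    obtain ⟨h1, h⟩ := h
    simp only [pathEnd_cons]
    rcases h1 with ⟨j, hi, rfl, rfl⟩ | ⟨j, hi, rfl, rfl⟩ | ⟨hi, rfl, rfl⟩ | ⟨hi, rfl, rfl⟩ |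
      ⟨hi, rfl, rfl⟩ | ⟨hi, rfl, rfl⟩
    · obtain rfl := Sum.inl.inj hi
      rw [obsP_u1]
      rcases ih j.succ (t + nv j) h with h' | ⟨h1, I, hI, K, hK⟩ | ⟨_, h0, _⟩
      · exact Or.inl h'
      · refine Or.inr (Or.inl ⟨h1, insert j I, ?_, K, ?_⟩)
        · intro k hk
          rcases Finset.mem_insert.1 hk with rfl | hk
          · exact le_rfl
          · exact (Fin.castSucc_lt_succ).le.trans (hI k hk)
        · have : j ∉ I := fun hj => absurd (hI j hj) (not_le.2 Fin.castSucc_lt_succ)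
          rw [hK, Finset.sum_insert this, add_assoc t]
      · exact absurd h0 (Fin.succ_ne_zero j)
    · obtain rfl := Sum.inl.inj hi
      rw [obsP_u2]
      rcases ih j.succ t h with h' | ⟨h1, I, hI, K, hK⟩ | ⟨_, h0, _⟩
      · exact Or.inl h'
      · exact Or.inr (Or.inl ⟨h1, I, fun k hk => (Fin.castSucc_lt_succ).le.trans (hI k hk), K, hK⟩)
      · exact absurd h0 (Fin.succ_ne_zero j)
    · refine Or.inr (Or.inl ⟨(loop_spec false t l h).1, ∅, by simp, l.length, ?_⟩)
      rw [obsP_false, (loop_spec false _ l h).2, tick_succ]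
      simp
    · refine Or.inr (Or.inr ⟨(loop_spec true t l h).1, Sum.inl.inj hi, l.length, ?_⟩)
      rw [obsP_start, (loop_spec true _ l h).2, tick_succ]
    · cases hi
    · cases hi

theorem complete (K : ℕ) (d : ℕ) (i : Fin (m + 1)) (hd : (i : ℕ) + d = m) (t : ℕ)
    (I : Finset (Fin m)) (hI : ∀ k ∈ I, i ≤ k.castSucc) :
    ∃ l, IsPath (A2 m nv N) (Sum.inl i) l ∧ pathEnd (Sum.inl i) l = Sum.inr false ∧
      obsP m nv N t (Sum.inl i) l = tick (t + ∑ k ∈ I, nv k + 1) (K + 1) := by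
  induction d generalizing i t I with
  | zero =>
    have hi : i = Fin.last m := Fin.ext (by simpa using hd)
    have hE : I = ∅ := by
      refine Finset.eq_empty_of_forall_notMem fun k hk => ?_
      have := hI k hk
      rw [hi] at this
      exact absurd this (not_le.2 (Fin.castSucc_lt_last k))
    have hp := loop_path (m := m) (nv := nv) (N := N) false K
    refine ⟨(Ev.vis, Sum.inr false) :: List.replicate K (Ev.vis, Sum.inr false), ?_, ?_, ?_⟩
    · rw [isPath_cons, mem_trans]
      exact ⟨by simp [hi], hp⟩
    · rw [pathEnd_cons]; exact (loop_spec false 0 _ hp).1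
    · rw [obsP_false, (loop_spec false _ _ hp).2, tick_succ]
      simp [hE]
  | succ d ih =>
    have hlt : (i : ℕ) < m := by omega
    obtain ⟨j, rfl⟩ : ∃ j : Fin m, i = j.castSucc := ⟨⟨i, hlt⟩, rfl⟩
    have key : ∀ k ∈ I, k ≠ j → j.succ ≤ k.castSucc := by
      intro k hk hne
      have h1 := hI k hk
      rw [Fin.le_def] at h1 ⊢
      have : (k : ℕ) ≠ j := fun h => hne (Fin.ext h)
      simp at h1 ⊢
      omega
    have hd' : ((j.succ : Fin (m + 1)) : ℕ) + d = m := by simp at hd ⊢; omega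
    by_cases hj : j ∈ I
    · obtain ⟨l, h1, h2, h3⟩ := ih j.succ hd' (t + nv j) (I.erase j)
        (fun k hk => key k (Finset.mem_of_mem_erase hk) (Finset.ne_of_mem_erase hk))
      refine ⟨(Ev.u1, Sum.inl j.succ) :: l, ?_, ?_, ?_⟩
      · rw [isPath_cons, mem_trans]
        exact ⟨Or.inl ⟨j, rfl, rfl, rfl⟩, h1⟩
      · rw [pathEnd_cons]; exact h2
      · rw [obsP_u1, h3, add_assoc t, Finset.add_sum_erase _ _ hj]
    · obtain ⟨l, h1, h2, h3⟩ := ih j.succ hd' t I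
        (fun k hk => key k hk (fun h => hj (h ▸ hk)))
      refine ⟨(Ev.u2, Sum.inl j.succ) :: l, ?_, ?_, ?_⟩
      · rw [isPath_cons, mem_trans]
        exact ⟨Or.inr (Or.inl ⟨j, rfl, rfl, rfl⟩), h1⟩
      · rw [pathEnd_cons]; exact h2
      · rw [obsP_u2, h3]

/-- A transition is observable iff it ends in one of the two sink states. -/
theorem trans_vis (q e q') (h : (q, e, q') ∈ (A2 m nv N).trans) :
    (A2 m nv N).lbl e ≠ none ↔ ∃ b, q' = Sum.inr b := by
  rw [mem_trans] at h
  rcases h with ⟨j, hi, rfl, rfl⟩ | ⟨j, hi, rfl, rfl⟩ | ⟨hi, rfl, rfl⟩ | ⟨hi, rfl, rfl⟩ |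
      ⟨hi, rfl, rfl⟩ | ⟨hi, rfl, rfl⟩ <;> simp [A2]

theorem last_vis (q l p) (h : IsPath (A2 m nv N) q (l ++ [p])) :
    (A2 m nv N).lbl p.1 ≠ none ↔ ∃ b, pathEnd q (l ++ [p]) = Sum.inr b := by
  rw [isPath_append] at h
  rw [pathEnd_append]
  exact trans_vis _ _ _ h.2.1

theorem mem_est (γ) (hγ : γ ≠ []) (q) : q ∈ est (A2 m nv N) (A2 m nv N).init γ ↔
    ∃ b, q = Sum.inr b ∧ ∃ l, IsPath (A2 m nv N) (Sum.inl 0) l ∧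
      pathEnd (Sum.inl 0) l = Sum.inr b ∧ obsP m nv N 0 (Sum.inl 0) l = γ := by
  have he : est (A2 m nv N) (A2 m nv N).init γ = estPos (A2 m nv N) (A2 m nv N).init γ := by
    cases γ with
    | nil => exact absurd rfl hγ
    | cons a l => rfl
  rw [he]
  constructor
  · rintro ⟨q₀, hq₀, s₁, s₂, hp, ⟨p, hp1, hp2⟩, ho, hu, -, hend⟩
    obtain rfl : q₀ = Sum.inl 0 := hq₀
    obtain ⟨s, rfl⟩ : ∃ s, s₁ = s ++ [p] := by
      obtain ⟨s, hs⟩ := List.getLast?_eq_some_iff.1 hp1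
      exact ⟨s, hs⟩
    rw [isPath_append] at hp
    obtain ⟨b, hb⟩ := (last_vis _ _ _ hp.1).1 hp2
    rw [hb] at hp hend
    have h2 := (loop_spec b 0 s₂ hp.2).1
    exact ⟨b, by rw [← hend, h2], _, hp.1, hb, ho⟩
  · rintro ⟨b, rfl, l, h1, h2, h3⟩
    refine ⟨Sum.inl 0, rfl, l, [], by simpa using h1, ?_, h3, by simp [Unobs],
      by simp [Inst, pathWWord, wwordAux], h2⟩
    rcases List.eq_nil_or_concat l with rfl | ⟨s, p, rfl⟩
    · cases h2
    · rw [List.concat_eq_append] at *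
      exact ⟨p, by simp, (last_vis _ _ _ h1).2 ⟨b, h2⟩⟩

theorem unobs_rank (q l) (h : IsPath (A2 m nv N) q l) (hu : Unobs (A2 m nv N) l) :
    Sum.elim (fun i : Fin (m + 1) => (i : ℕ)) (fun _ => 0) (pathEnd q l) =
      Sum.elim (fun i : Fin (m + 1) => (i : ℕ)) (fun _ => 0) q + l.length := by
  induction l generalizing q with
  | nil => rfl
  | cons a l ih =>
    obtain ⟨e, q'⟩ := a
    rw [isPath_cons, mem_trans] at h
    have h0 := hu (e, q') (by simp)
    rw [pathEnd_cons, ih q' h.2 (fun p hp => hu p (by simp [hp]))]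
    rcases h.1 with ⟨j, rfl, rfl, rfl⟩ | ⟨j, rfl, rfl, rfl⟩ | ⟨hi, rfl, rfl⟩ | ⟨hi, rfl, rfl⟩ |
      ⟨hi, rfl, rfl⟩ | ⟨hi, rfl, rfl⟩
    · simp; omega
    · simp; omega
    all_goals simp [A2] at h0

/-- The infinite path through the second sink. -/
def path2 (m : ℕ) (nv : Fin m → ℕ) (N : ℕ) : InfPath (A2 m nv N) where
  st := fun n => if n = 0 then Sum.inl 0 else Sum.inr true
  ev := fun _ => Ev.vis
  first := rfl
  valid := by
    intro i
    rw [mem_trans]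
    by_cases h : i = 0 <;> simp [h]

theorem path2_obs (K : ℕ) :
    obsW (A2 m nv N) (pre (path2 m nv N).wword (K + 1)) = tick (N + 1) (K + 1) := by
  obtain ⟨h1, h2, -, h4⟩ := prePath_spec (path2 m nv N) (K + 1)
  have hr : prePath (path2 m nv N) (K + 1) =
      (Ev.vis, Sum.inr true) :: List.replicate K (Ev.vis, Sum.inr true) := by
    rw [← List.replicate_succ, List.eq_replicate_iff]
    simp [prePath, path2]
  rw [← h4, hr]
  change obsP m nv N 0 (Sum.inl 0) _ = _
  rw [obsP_start, (loop_spec true _ _ (loop_path true K)).2, tick_succ]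
  simp

theorem det_iff : (∃ I : Finset (Fin m), N = ∑ i ∈ I, nv i) ↔
    ¬ StronglyDetectable (A2 m nv N) := by
  constructor
  · rintro ⟨I, hI⟩ ⟨t, ht, H⟩
    obtain ⟨K, rfl⟩ : ∃ K, t = K + 1 := ⟨t - 1, by omega⟩
    have := H (path2 m nv N).wword ⟨_, fun _ => rfl⟩ (K + 1) (by rw [path2_obs]; simp [tick])
    obtain ⟨a, ha⟩ := Set.ncard_eq_one.1 this
    have hne : tick (N + 1) (K + 1) ≠ [] := by simp [tick_succ]
    have hT : (Sum.inr true) ∈ est (A2 m nv N) (A2 m nv N).init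
        (obsW (A2 m nv N) (pre (path2 m nv N).wword (K + 1))) := by
      obtain ⟨h1, h2, -, h4⟩ := prePath_spec (path2 m nv N) (K + 1)
      refine (mem_est _ (by rwa [path2_obs]) _).2 ⟨true, rfl, _, h1, h2, ?_⟩
      rw [← h4]; rfl
    have hF : (Sum.inr false) ∈ est (A2 m nv N) (A2 m nv N).init
        (obsW (A2 m nv N) (pre (path2 m nv N).wword (K + 1))) := by
      rw [path2_obs, mem_est _ hne]
      obtain ⟨l, h1, h2, h3⟩ := complete (m := m) (nv := nv) (N := N) K m 0 (by simp) 0 I (by simp)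
      exact ⟨false, rfl, l, h1, h2, by rw [h3, ← hI, zero_add]⟩
    rw [ha] at hT hF
    have := hT.trans hF.symm
    simp at this
  · intro h
    by_contra hno
    refine h ⟨1, one_pos, ?_⟩
    rintro w ⟨π, hw⟩ n hn
    obtain rfl : π.wword = w := funext hw
    obtain ⟨h1, h2, -, h4⟩ := prePath_spec π n
    have hs : π.st 0 = Sum.inl 0 := π.first
    rw [hs] at h1 h2 h4
    rw [← h4] at hn ⊢
    change 1 ≤ (obsP m nv N 0 (Sum.inl 0) _).length at hn
    change (est _ _ (obsP m nv N 0 (Sum.inl 0) _)).ncard = 1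
    generalize prePath π n = l at *
    have hne : obsP m nv N 0 (Sum.inl 0) l ≠ [] := by
      intro h; rw [h] at hn; simp at hn
    have huniq : ∀ l' b b', IsPath (A2 m nv N) (Sum.inl 0) l' →
        pathEnd (Sum.inl 0) l = Sum.inr b → pathEnd (Sum.inl 0) l' = Sum.inr b' →
        obsP m nv N 0 (Sum.inl 0) l' = obsP m nv N 0 (Sum.inl 0) l → b' = b := by
      intro l' b b' h' hb hb' ho
      rcases sound 0 0 l h1 with ⟨-, h⟩ | ⟨he, I, -, K, hK⟩ | ⟨he, -, K, hK⟩
      · exact absurd h hne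
      all_goals
        rcases sound 0 0 l' h' with ⟨-, h⟩ | ⟨he', I', -, K', hK'⟩ | ⟨he', -, K', hK'⟩
        · exact absurd (ho ▸ h) hne
      · exact Sum.inr.inj ((hb'.symm.trans he').trans (he.symm.trans hb))
      · have := tick_inj (hK'.symm.trans (ho.trans hK))
        exact absurd ⟨I, by omega⟩ hno
      · have := tick_inj (hK'.symm.trans (ho.trans hK))
        exact absurd ⟨I', by omega⟩ hno
      · exact Sum.inr.inj ((hb'.symm.trans he').trans (he.symm.trans hb))
    obtain ⟨b, hb⟩ : ∃ b, pathEnd (Sum.inl 0) l = Sum.inr b := by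
      rcases sound 0 0 l h1 with ⟨-, h⟩ | ⟨he, -⟩ | ⟨he, -⟩
      · exact absurd h hne
      · exact ⟨_, he⟩
      · exact ⟨_, he⟩
    rw [Set.ncard_eq_one]
    refine ⟨Sum.inr b, Set.ext fun q => ?_⟩
    rw [mem_est _ hne, Set.mem_singleton_iff]
    constructor
    · rintro ⟨b', rfl, l', h', hb', ho⟩
      rw [huniq l' b b' h' hb hb' ho]
    · rintro rfl
      exact ⟨b, rfl, l, h1, hb, rfl⟩

end a2

/-- Theorem: `A₂` is deterministic, deadlock-free and divergence-free, and the
subset-sum instance `(n₁, …, n_m, N)` has a solution iff `A₂` is not strongly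
detectable. -/
theorem A2_det_df_divf_and_subsetSum_iff_not_stronglyDetectable
    (m : ℕ) (hm : 0 < m) (nv : Fin m → ℕ) (hnv : ∀ i, 0 < nv i)
    (N : ℕ) (hN : 0 < N) :
    Deterministic (A2 m nv N) ∧ DeadlockFree (A2 m nv N) ∧
      DivergenceFree (A2 m nv N) ∧
      ((∃ I : Finset (Fin m), N = ∑ i ∈ I, nv i) ↔
        ¬ StronglyDetectable (A2 m nv N)) := by
  refine ⟨⟨⟨Sum.inl 0, rfl⟩, ?_⟩, ?_, ?_, det_iff⟩
  · intro q e q' q'' h1 h2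
    have hl : (Fin.last m) ≠ 0 := by
      intro h
      have := congrArg Fin.val h
      simp at this
      omega
    rw [mem_trans] at h1 h2
    rcases h1 with ⟨j, rfl, rfl, rfl⟩ | ⟨j, rfl, rfl, rfl⟩ | ⟨rfl, rfl, rfl⟩ | ⟨rfl, rfl, rfl⟩ |
      ⟨rfl, rfl, rfl⟩ | ⟨rfl, rfl, rfl⟩
    · simp at h2; obtain ⟨k, rfl, rfl⟩ := h2; rfl
    · simp at h2; obtain ⟨k, rfl, rfl⟩ := h2; rfl
    · simp [hl] at h2; exact h2.symm
    · simp [hl.symm] at h2; exact h2.symm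
    · simp at h2; exact h2.symm
    · simp at h2; exact h2.symm
  · rintro (i | b) -
    · refine Fin.lastCases ?_ (fun j => ?_) i
      · exact ⟨Ev.vis, Sum.inr false, (mem_trans _ _ _).2 (by simp)⟩
      · exact ⟨Ev.u1, Sum.inl j.succ, (mem_trans _ _ _).2 (Or.inl ⟨j, rfl, rfl, rfl⟩)⟩
    · exact ⟨Ev.vis, Sum.inr b, (loop_trans _ _ _).2 ⟨rfl, rfl⟩⟩
  · rintro ⟨q, -, l, hl, hp, hu, he⟩
    have := unobs_rank q l hp hu
    rw [he] at this
    have := List.length_pos_iff.2 hl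
    omega

end LWAD
end

section
/- Let G = (V, A) be a finite directed graph with maps tail, head : A → V, let s, t ∈ V be distinct, and let y : A → ℕ satisfy the flow conditions for s, t and the local condition. Let C be a realizable simple cycle of G (a cycle all of whose edges are realizable and whose intermediate vertices are pairwise distinct), and define y' : A → ℕ by y'_a = y_a − 1 if a is an edge of C and y'_a = y_a otherwise. Then y' again satisfies the flow conditions for s, t and the local condition. -/
namespace EGraph

variable {V A : Type*}

/-- `l` is a chain of consecutive edges (`head aᵢ = tail aᵢ₊₁`). -/
def GChain (tl hd : A → V) (l : List A) : Prop := l.Chain' fun a b => hd a = tl b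

/-- `l` is a (nonempty) path from vertex `u` to vertex `v`. -/
def GPathFromTo (tl hd : A → V) (u v : V) (l : List A) : Prop :=
  l ≠ [] ∧ GChain tl hd l ∧
    (∃ a, l.head? = some a ∧ tl a = u) ∧ (∃ a, l.getLast? = some a ∧ hd a = v)

/-- The flow conditions for source `s` and sink `t`. -/
def FlowCond [Fintype A] [DecidableEq V] (tl hd : A → V) (s t : V) (y : A → ℕ) : Prop :=
  (∀ v : V, v ≠ s → v ≠ t →
      ∑ a ∈ Finset.univ.filter (fun a => tl a = v), y a =
        ∑ a ∈ Finset.univ.filter (fun a => hd a = v), y a) ∧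
  (∑ a ∈ Finset.univ.filter (fun a => tl a = s), y a =
      (∑ a ∈ Finset.univ.filter (fun a => hd a = s), y a) + 1) ∧
  ((∑ a ∈ Finset.univ.filter (fun a => tl a = t), y a) + 1 =
      ∑ a ∈ Finset.univ.filter (fun a => hd a = t), y a)

/-- `b` is an edge of the subgraph `G^a` (w.r.t. sink `t`): `b = a` or `b`
lies on some path from `head a` to `t`. -/
def InSub (tl hd : A → V) (t : V) (a b : A) : Prop :=
  b = a ∨ ∃ l : List A, GPathFromTo tl hd (hd a) t l ∧ b ∈ l

/-- The local condition: every realizable edge `a` with `head a ≠ t` is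
followed in `G^a` by a realizable edge starting at `head a`. -/
def LocalCond (tl hd : A → V) (t : V) (y : A → ℕ) : Prop :=
  ∀ a : A, 0 < y a → hd a ≠ t →
    ∃ b : A, InSub tl hd t a b ∧ tl b = hd a ∧ 0 < y b

/-- The global condition: from the head of every realizable edge (other than
`t`) there is a realizable path to `t`. -/
def GlobalCond (tl hd : A → V) (t : V) (y : A → ℕ) : Prop :=
  ∀ a : A, 0 < y a → hd a ≠ t →
    ∃ l : List A, GPathFromTo tl hd (hd a) t l ∧ ∀ b ∈ l, 0 < y b


theorem map_hd_eq (tl hd : A → V) (w : V) : ∀ (l : List A) (a : A), GChain tl hd (a :: l) →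
    (∃ b, (a :: l).getLast? = some b ∧ hd b = w) → (a :: l).map hd = l.map tl ++ [w] := by
  intro l
  induction l with
  | nil =>
    rintro a - ⟨b, hb, rfl⟩
    simp at hb
    simp [hb]
  | cons c l ih =>
    intro a hch hb
    have h := List.isChain_cons_cons.1 hch
    have := ih c h.2 (by simpa using hb)
    rw [List.map_cons, this, h.1]
    simp

theorem sum_sub [Fintype A] [DecidableEq V] [DecidableEq A] (f : A → V) (y : A → ℕ)
    (C : List A) (hC : ∀ b ∈ C, 0 < y b) (hnd : C.Nodup) (v : V) :
    ∑ a ∈ Finset.univ.filter (fun a => f a = v), y a =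
      ∑ a ∈ Finset.univ.filter (fun a => f a = v), (if a ∈ C then y a - 1 else y a) +
        (C.map f).count v := by
  have h1 : (C.map f).count v =
      ∑ a ∈ Finset.univ.filter (fun a => f a = v), (if a ∈ C then 1 else 0) := by
    rw [Finset.sum_boole, Finset.filter_filter, List.count, List.countP_map,
      List.countP_eq_length_filter, ← List.toFinset_card_of_nodup (hnd.filter _)]
    simp only [Nat.cast_id]
    congr 1
    ext a
    simp [and_comm]
  rw [h1, ← Finset.sum_add_distrib]
  refine Finset.sum_congr rfl fun a _ => ?_
  split_ifs with h
  · have := hC a h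
    omega
  · rfl

theorem cons_path (tl hd : A → V) (b : A) (t : V) (l : List A)
    (h : GPathFromTo tl hd (hd b) t l) : GPathFromTo tl hd (tl b) t (b :: l) := by
  obtain ⟨hne, hch, ⟨a, ha, hta⟩, c, hc, hhc⟩ := h
  cases l with
  | nil => exact absurd rfl hne
  | cons d l =>
    simp at ha
    subst ha
    exact ⟨by simp, List.isChain_cons_cons.2 ⟨hta.symm, hch⟩, ⟨b, rfl, rfl⟩, c, by simpa using hc, hhc⟩

/-- Subtracting `1` from `y` along a realizable simple cycle preserves the flow
conditions and the local condition. -/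
theorem subtract_realizable_simple_cycle
    [Fintype V] [Fintype A] [DecidableEq V] [DecidableEq A]
    (tl hd : A → V) (s t : V) (hst : s ≠ t) (y : A → ℕ)
    (hflow : FlowCond tl hd s t y) (hloc : LocalCond tl hd t y)
    (C : List A) (hCne : C ≠ []) (hCchain : GChain tl hd C)
    (hCcyc : ∃ a₁ aₙ, C.head? = some a₁ ∧ C.getLast? = some aₙ ∧ hd aₙ = tl a₁)
    (hCreal : ∀ b ∈ C, 0 < y b) (hCsimple : (C.map tl).Nodup) :
    FlowCond tl hd s t (fun a => if a ∈ C then y a - 1 else y a) ∧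
      LocalCond tl hd t (fun a => if a ∈ C then y a - 1 else y a) := by
  have hnd : C.Nodup := List.Nodup.of_map _ hCsimple
  have hcount : ∀ v, (C.map hd).count v = (C.map tl).count v := by
    intro v
    obtain ⟨a₁, aₙ, h1, h2, h3⟩ := hCcyc
    cases C with
    | nil => exact absurd rfl hCne
    | cons c l =>
      simp at h1
      subst h1
      rw [map_hd_eq tl hd (tl c) l c hCchain ⟨aₙ, h2, h3⟩]
      simp [List.count_cons]
  have hT := sum_sub tl y C hCreal hnd
  have hH := sum_sub hd y C hCreal hnd
  have hflow' : FlowCond tl hd s t (fun a => if a ∈ C then y a - 1 else y a) := by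
    obtain ⟨f1, f2, f3⟩ := hflow
    refine ⟨fun v hs ht => ?_, ?_, ?_⟩
    · have := f1 v hs ht
      have := hT v
      have := hH v
      have := hcount v
      beta_reduce
      omega
    · have := hT s
      have := hH s
      have := hcount s
      beta_reduce
      omega
    · have := hT t
      have := hH t
      have := hcount t
      beta_reduce
      omega
  refine ⟨hflow', ?_⟩
  have hle : ∀ a, 0 < (if a ∈ C then y a - 1 else y a) → 0 < y a := by
    intro a h
    split_ifs at h <;> omega
  intro a ha hat
  by_cases hloop : tl a = hd a
  · exact ⟨a, Or.inl rfl, hloop, ha⟩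
  obtain ⟨b, hb, hbt, hby⟩ := hloc a (hle a ha) hat
  rcases hb with rfl | ⟨l, hl, -⟩
  · exact absurd hbt hloop
  have hin : 0 < ∑ c ∈ Finset.univ.filter (fun c => hd c = hd a),
      (if c ∈ C then y c - 1 else y c) :=
    lt_of_lt_of_le ha (Finset.single_le_sum
      (f := fun c => if c ∈ C then y c - 1 else y c) (fun _ _ => Nat.zero_le _) (by simp))
  have hout : 0 < ∑ c ∈ Finset.univ.filter (fun c => tl c = hd a),
      (if c ∈ C then y c - 1 else y c) := by
    by_cases hs : hd a = s
    · have := hflow'.2.1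
      rw [hs]
      beta_reduce at this
      omega
    · have := hflow'.1 (hd a) hs hat
      beta_reduce at this
      omega
  obtain ⟨c, hc, hcy⟩ := Finset.exists_ne_zero_of_sum_ne_zero hout.ne'
  have hct : tl c = hd a := by simpa using hc
  refine ⟨c, Or.inr ?_, hct, Nat.pos_of_ne_zero hcy⟩
  by_cases hcht : hd c = t
  · exact ⟨[c], ⟨by simp, List.isChain_singleton _, ⟨c, rfl, hct⟩, c, rfl, hcht⟩, by simp⟩
  obtain ⟨d, hd', hdt, -⟩ := hloc c (hle c (Nat.pos_of_ne_zero hcy)) hcht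
  rcases hd' with rfl | ⟨l', hl', -⟩
  · refine ⟨d :: l, ?_, by simp⟩
    rw [← hct]
    apply cons_path
    rwa [← hdt, hct]
  · refine ⟨c :: l', ?_, by simp⟩
    rw [← hct]
    exact cons_path _ _ _ _ _ hl'

end EGraph
end

section
/- Let A be a labeled weighted automaton over a monoid 𝔐 = (T, ⊗, 1) that is deadlock-free and divergence-free. If A is weakly detectable, then A is weakly periodically detectable. -/
namespace LWAD

variable {T Q E S : Type*} [Monoid T]

/-- The finite segment of length `k` of an infinite path, starting at position `i`. -/
def plist {A : LWA T Q E S} (π : InfPath A) : ℕ → ℕ → List (E × Q)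
  | _, 0 => []
  | i, k + 1 => (π.ev i, π.st (i + 1)) :: plist π (i + 1) k

theorem chainEnd_cons' {V α : Type*} (v : V) (p : α × V) (l : List (α × V)) :
    chainEnd v (p :: l) = chainEnd p.2 l := by
  cases l with
  | nil => simp [chainEnd]
  | cons b l =>
    simp only [chainEnd, List.getLast?_cons_cons]
    rw [List.getLast?_cons]
    simp

theorem plist_isPath {A : LWA T Q E S} (π : InfPath A) (k : ℕ) :
    ∀ i, IsPath A (π.st i) (plist π i k) := by
  induction k with
  | zero => intro i; simp [plist, IsPath, Chain]
  | succ k ih => intro i; exact ⟨π.valid i, ih (i + 1)⟩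

theorem plist_end {A : LWA T Q E S} (π : InfPath A) (k : ℕ) :
    ∀ i, pathEnd (π.st i) (plist π i k) = π.st (i + k) := by
  induction k with
  | zero => intro i; simp [plist, pathEnd, chainEnd]
  | succ k ih =>
    intro i
    have h := ih (i + 1)
    simp only [pathEnd] at h ⊢
    rw [plist, chainEnd_cons', h]
    congr 1
    omega

theorem plist_unobs {A : LWA T Q E S} (π : InfPath A) (k : ℕ) :
    ∀ i, (∀ j, i ≤ j → A.lbl (π.ev j) = none) → Unobs A (plist π i k) := by
  induction k with
  | zero => intro i _ p hp; simp [plist] at hp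
  | succ k ih =>
    intro i h p hp
    rw [plist, List.mem_cons] at hp
    rcases hp with rfl | hp
    · exact h i le_rfl
    · exact ih (i + 1) (fun j hj => h j (by omega)) p hp

theorem exists_obs [Finite Q] {A : LWA T Q E S} (hdiv : DivergenceFree A) (π : InfPath A)
    (N : ℕ) : ∃ j, N ≤ j ∧ A.lbl (π.ev j) ≠ none := by
  by_contra hcon
  push Not at hcon
  obtain ⟨a, b, hab, heq⟩ :=
    Finite.exists_ne_map_eq_of_infinite (fun i : ℕ => π.st (N + i))
  wlog hlt : a < b generalizing a b
  · exact this b a hab.symm heq.symm (by omega)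
  apply hdiv
  refine ⟨π.st (N + a), ⟨π.st 0, π.first, plist π 0 (N + a), plist_isPath π _ 0, ?_⟩,
    plist π (N + a) (b - a), ?_, plist_isPath π _ _,
    plist_unobs π _ _ (fun j hj => hcon j (by omega)), ?_⟩
  · rw [plist_end]; simp
  · obtain ⟨c, hc⟩ : ∃ c, b - a = c + 1 := ⟨b - a - 1, by omega⟩
    rw [hc, plist]; simp
  · rw [plist_end]
    have : N + a + (b - a) = N + b := by omega
    rw [this]; exact heq.symm

theorem seg_succ {β : Type*} (w : ℕ → β) (n k : ℕ) :
    seg w n (k + 1) = seg w n k ++ [w (n + k)] := by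
  simp [seg, List.range_succ]

theorem pre_add {β : Type*} (w : ℕ → β) (n k : ℕ) :
    pre w (n + k) = pre w n ++ seg w n k := by
  simp [pre, seg, List.range_add]

theorem exists_seg_length (A : LWA T Q E S) (w : ℕ → E × T)
    (h : ∀ N, ∃ j, N ≤ j ∧ A.lbl (w j).1 ≠ none) (n m : ℕ) :
    ∃ k, (obsW A (seg w n k)).length = m := by
  have step : ∀ k, (obsW A (seg w n (k + 1))).length ≤ (obsW A (seg w n k)).length + 1 ∧
      (obsW A (seg w n k)).length ≤ (obsW A (seg w n (k + 1))).length ∧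
      (A.lbl (w (n + k)).1 ≠ none →
        (obsW A (seg w n (k + 1))).length = (obsW A (seg w n k)).length + 1) := by
    intro k
    rw [seg_succ]
    cases hl : A.lbl (w (n + k)).1 <;> simp [obsW, hl]
  have mono : Monotone fun k => (obsW A (seg w n k)).length :=
    monotone_nat_of_le_succ fun k => (step k).2.1
  have large : ∀ m, ∃ k, m ≤ (obsW A (seg w n k)).length := by
    intro m
    induction m with
    | zero => exact ⟨0, Nat.zero_le _⟩
    | succ m ih =>
      obtain ⟨k, hk⟩ := ih
      obtain ⟨j, hj, ho⟩ := h (n + k)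
      obtain ⟨c, rfl⟩ : ∃ c, j = n + c := ⟨j - n, by omega⟩
      refine ⟨c + 1, ?_⟩
      have h1 := (step c).2.2 ho
      have h2 : (obsW A (seg w n k)).length ≤ (obsW A (seg w n c)).length :=
        mono (by omega : k ≤ c)
      omega
  classical
  have hs := Nat.find_spec (large m)
  have hm := fun i => Nat.find_min (large m) (m := i)
  generalize Nat.find (large m) = k at hs hm
  refine ⟨k, ?_⟩
  cases k with
  | zero =>
    have : (obsW A (seg w n 0)).length = 0 := by simp [seg, obsW]
    omega
  | succ k =>
    have h1 := hm k (by omega)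
    have h2 := (step k).1
    omega

/-- For deadlock-free and divergence-free labeled weighted automata over a
monoid, weak detectability implies weak periodic detectability. -/
theorem weaklyDetectable_implies_weaklyPeriodicallyDetectable
    [Fintype Q] [Fintype E] [Fintype S] (A : LWA T Q E S)
    (hdl : DeadlockFree A) (hdiv : DivergenceFree A)
    (hwd : WeaklyDetectable A) :
    WeaklyPeriodicallyDetectable A := by
  intro hne
  obtain ⟨t, ht, w, ⟨π, hπ⟩, hw⟩ := hwd hne
  refine ⟨t + 1, by omega, w, ⟨π, hπ⟩, fun n => ?_⟩
  have hobs : ∀ N, ∃ j, N ≤ j ∧ A.lbl (w j).1 ≠ none := by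
    intro N
    obtain ⟨j, hj, ho⟩ := exists_obs hdiv π N
    refine ⟨j, hj, ?_⟩
    rw [← hπ j]
    exact ho
  obtain ⟨k, hk⟩ := exists_seg_length A w hobs n t
  refine ⟨k, by omega, hw _ ?_⟩
  rw [pre_add]
  have : (obsW A (pre w n ++ seg w n k)).length =
      (obsW A (pre w n)).length + (obsW A (seg w n k)).length := by
    simp [obsW]
  omega

end LWAD
end

section
/- Let A be a labeled weighted automaton over the monoid (ℤ, +, 0) and let q₁, q₂ be states of A. Define the asynchronous product A_{q₁} ⊗ A_{q₂} as the weighted directed graph whose vertices are pairs (p₁, p₂) of states of A and whose edges are: (p₁, p₂) → (p₁, p₃) with weight −μ(e)_{p₂p₃} for every unobservable transition p₂ →^{e} p₃ of A, and (p₁, p₂) → (p₃, p₂) with weight μ(e)_{p₁p₃} for every unobservable transition p₁ →^{e} p₃ of A. Then for all states q₅, q₆ of A and every w ∈ ℤ, there exists a (possibly empty) path from (q₁, q₂) to (q₅, q₆) in A_{q₁} ⊗ A_{q₂} with total weight w if and only if there exist (possibly empty) unobservable paths π₁ from q₁ to q₅ and π₂ from q₂ to q₆ in A such that WEIGHT(π₁)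 − WEIGHT(π₂) = w (the weight of a path being the sum of the weights of its transitions, with empty paths having weight 0). -/
namespace LWAD

variable {T Q E S : Type*} [Monoid T]

/-- One weighted edge of the asynchronous product `A_{q₁} ⊗ A_{q₂}`: either the
right component takes an unobservable transition (with negated weight) or the
left component does (with its weight). The monoid `(ℤ, +, 0)` is encoded as
`Multiplicative ℤ`. -/
def AsyncStep (A : LWA (Multiplicative ℤ) Q E S)
    (p : Q × Q) (w : ℤ) (p' : Q × Q) : Prop :=
  (∃ e, A.lbl e = none ∧ (p.2, e, p'.2) ∈ A.trans ∧ p'.1 = p.1 ∧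
      w = -Multiplicative.toAdd (A.wt p.2 e p'.2)) ∨
  (∃ e, A.lbl e = none ∧ (p.1, e, p'.1) ∈ A.trans ∧ p'.2 = p.2 ∧
      w = Multiplicative.toAdd (A.wt p.1 e p'.1))

theorem chainEnd_cons_aux {V α : Type*} (v u : V) (a : α) (l : List (α × V)) :
    chainEnd v ((a, u) :: l) = chainEnd u l := by
  cases l with
  | nil => rfl
  | cons b l => simp [chainEnd, List.getLast?_cons]

theorem async_forward_aux (A : LWA (Multiplicative ℤ) Q E S) (q₅ q₆ : Q) :
    ∀ (l : List (ℤ × (Q × Q))) (q₁ q₂ : Q), Chain (AsyncStep A) (q₁, q₂) l →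
      chainEnd (q₁, q₂) l = (q₅, q₆) →
      ∃ l₁ l₂ : List (E × Q),
        IsPath A q₁ l₁ ∧ Unobs A l₁ ∧ pathEnd q₁ l₁ = q₅ ∧
        IsPath A q₂ l₂ ∧ Unobs A l₂ ∧ pathEnd q₂ l₂ = q₆ ∧
        Multiplicative.toAdd (pathWeight A q₁ l₁)
          - Multiplicative.toAdd (pathWeight A q₂ l₂) = (l.map Prod.fst).sum := by
  intro l
  induction l with
  | nil =>
    intro q₁ q₂ _ h
    have h' : (q₁, q₂) = (q₅, q₆) := h
    obtain ⟨rfl, rfl⟩ := Prod.mk.inj h'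
    exact ⟨[], [], trivial, by simp [Unobs], rfl, trivial, by simp [Unobs], rfl,
      by simp [pathWeight]⟩
  | cons x l ih =>
    obtain ⟨a, p₁, p₂⟩ := x
    intro q₁ q₂ hc he
    rw [chainEnd_cons_aux] at he
    obtain ⟨hs, hc⟩ := hc
    obtain ⟨l₁, l₂, h1, h2, h3, h4, h5, h6, h7⟩ := ih p₁ p₂ hc he
    rcases hs with ⟨e, hl, ht, hp, hw⟩ | ⟨e, hl, ht, hp, hw⟩
    · simp only at ht hp hw
      subst hp
      refine ⟨l₁, (e, p₂) :: l₂, h1, h2, h3, ⟨ht, h4⟩, ?_, ?_, ?_⟩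
      · simpa [Unobs, hl] using h5
      · rw [pathEnd, chainEnd_cons_aux]; exact h6
      · simp only [pathWeight, toAdd_mul, List.map_cons, List.sum_cons]; linarith
    · simp only at ht hp hw
      subst hp
      refine ⟨(e, p₁) :: l₁, l₂, ⟨ht, h1⟩, ?_, ?_, h4, h5, h6, ?_⟩
      · simpa [Unobs, hl] using h2
      · rw [pathEnd, chainEnd_cons_aux]; exact h3
      · simp only [pathWeight, toAdd_mul, List.map_cons, List.sum_cons]; linarith

theorem async_backward_right_aux (A : LWA (Multiplicative ℤ) Q E S) (q₁ : Q) :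
    ∀ (l₂ : List (E × Q)) (q₂ : Q), IsPath A q₂ l₂ → Unobs A l₂ →
      ∃ l : List (ℤ × (Q × Q)), Chain (AsyncStep A) (q₁, q₂) l ∧
        chainEnd (q₁, q₂) l = (q₁, pathEnd q₂ l₂) ∧
        (l.map Prod.fst).sum = - Multiplicative.toAdd (pathWeight A q₂ l₂) := by
  intro l₂
  induction l₂ with
  | nil => intro q₂ _ _; exact ⟨[], trivial, rfl, by simp [pathWeight]⟩
  | cons x l₂ ih =>
    obtain ⟨e, p⟩ := x
    intro q₂ hp hu
    obtain ⟨l, h1, h2, h3⟩ := ih p hp.2 (fun y hy => hu y (List.mem_cons_of_mem _ hy))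
    refine ⟨(-Multiplicative.toAdd (A.wt q₂ e p), (q₁, p)) :: l, ⟨?_, h1⟩, ?_, ?_⟩
    · exact Or.inl ⟨e, hu (e, p) List.mem_cons_self, hp.1, rfl, rfl⟩
    · rw [pathEnd, chainEnd_cons_aux, chainEnd_cons_aux]; exact h2
    · simp only [pathWeight, toAdd_mul, List.map_cons, List.sum_cons]; linarith

theorem async_backward_aux (A : LWA (Multiplicative ℤ) Q E S) (q₂ : Q) (l₂ : List (E × Q))
    (hp₂ : IsPath A q₂ l₂) (hu₂ : Unobs A l₂) :
    ∀ (l₁ : List (E × Q)) (q₁ : Q), IsPath A q₁ l₁ → Unobs A l₁ →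
      ∃ l : List (ℤ × (Q × Q)), Chain (AsyncStep A) (q₁, q₂) l ∧
        chainEnd (q₁, q₂) l = (pathEnd q₁ l₁, pathEnd q₂ l₂) ∧
        (l.map Prod.fst).sum = Multiplicative.toAdd (pathWeight A q₁ l₁)
          - Multiplicative.toAdd (pathWeight A q₂ l₂) := by
  intro l₁
  induction l₁ with
  | nil =>
    intro q₁ _ _
    obtain ⟨l, h1, h2, h3⟩ := async_backward_right_aux A q₁ l₂ q₂ hp₂ hu₂
    exact ⟨l, h1, h2, by simp [pathWeight, h3]⟩
  | cons x l₁ ih =>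
    obtain ⟨e, p⟩ := x
    intro q₁ hp hu
    obtain ⟨l, h1, h2, h3⟩ := ih p hp.2 (fun y hy => hu y (List.mem_cons_of_mem _ hy))
    refine ⟨(Multiplicative.toAdd (A.wt q₁ e p), (p, q₂)) :: l, ⟨?_, h1⟩, ?_, ?_⟩
    · exact Or.inr ⟨e, hu (e, p) List.mem_cons_self, hp.1, rfl, rfl⟩
    · rw [pathEnd, chainEnd_cons_aux, chainEnd_cons_aux]; exact h2
    · simp only [pathWeight, toAdd_mul, List.map_cons, List.sum_cons]; linarith

/-- There is a (possibly empty) path of total weight `w` from `(q₁, q₂)` to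
`(q₅, q₆)` in the asynchronous product iff there are (possibly empty)
unobservable paths `π₁ : q₁ ⇝ q₅` and `π₂ : q₂ ⇝ q₆` of `A` with
`WEIGHT(π₁) − WEIGHT(π₂) = w`. -/
theorem asyncProduct_path_weight_iff
    [Fintype Q] [Fintype E] [Fintype S]
    (A : LWA (Multiplicative ℤ) Q E S) (q₁ q₂ q₅ q₆ : Q) (w : ℤ) :
    (∃ l : List (ℤ × (Q × Q)), Chain (AsyncStep A) (q₁, q₂) l ∧
        chainEnd (q₁, q₂) l = (q₅, q₆) ∧ (l.map Prod.fst).sum = w) ↔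
      (∃ l₁ l₂ : List (E × Q),
        IsPath A q₁ l₁ ∧ Unobs A l₁ ∧ pathEnd q₁ l₁ = q₅ ∧
        IsPath A q₂ l₂ ∧ Unobs A l₂ ∧ pathEnd q₂ l₂ = q₆ ∧
        Multiplicative.toAdd (pathWeight A q₁ l₁)
          - Multiplicative.toAdd (pathWeight A q₂ l₂) = w) := by
  constructor
  · rintro ⟨l, hc, he, rfl⟩
    exact async_forward_aux A q₅ q₆ l q₁ q₂ hc he
  · rintro ⟨l₁, l₂, h1, h2, rfl, h4, h5, rfl, rfl⟩
    exact async_backward_aux A q₂ l₂ h4 h5 l₁ q₁ h1 h2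

end LWAD
end
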